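/- arXiv:math-ph/0411012 — 2 statements merged into one kernel-verified Lean document; each statement's English description precedes it below -/
import Mathlib

section
/- Let a₁, a₂ ∈ ℝ² be linearly independent over ℝ and let Γ = { l₁a₁ + l₂a₂ : l₁, l₂ ∈ ℤ }. Let H : ℝ² → ℝ be smooth and Γ-periodic, i.e. H(y+γ) = H(y) for all y ∈ ℝ², γ ∈ Γ. Let γ : ℝ → ℝ² be a continuously differentiable solution of the Hamiltonian system γ'(t) = ( −∂H/∂y₂(γ(t)), ∂H/∂y₁(γ(t)) ). If the gradient ∇H(y) is nonzero for every y ∈ ℝ² with H(y) = H(γ(0)), then there exist T > 0 and d = (d₁,d₂) ∈ ℤ² such that γ(t+T) = γ(t) + d₁a₁ + d₂a₂ for all t ∈ ℝ. -/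
open Real

noncomputable section

/-- Partial derivative in the first variable of a real function on `ℝ × ℝ`. -/
def rpd1 (f : ℝ × ℝ → ℝ) (x : ℝ × ℝ) : ℝ := deriv (fun t => f (t, x.2)) x.1

/-- Partial derivative in the second variable of a real function on `ℝ × ℝ`. -/
def rpd2 (f : ℝ × ℝ → ℝ) (x : ℝ × ℝ) : ℝ := deriv (fun t => f (x.1, t)) x.2

open Filter Topology

lemma rpd1_eq_fderiv {f : ℝ × ℝ → ℝ} {x : ℝ × ℝ} (hf : DifferentiableAt ℝ f x) :
    rpd1 f x = fderiv ℝ f x (1, 0) := by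
  have h : HasDerivAt (fun t : ℝ => (t, x.2)) ((1 : ℝ), (0 : ℝ)) x.1 :=
    (hasDerivAt_id x.1).prodMk (hasDerivAt_const x.1 x.2)
  exact (HasFDerivAt.comp_hasDerivAt (l := f) x.1 hf.hasFDerivAt h).deriv

lemma rpd2_eq_fderiv {f : ℝ × ℝ → ℝ} {x : ℝ × ℝ} (hf : DifferentiableAt ℝ f x) :
    rpd2 f x = fderiv ℝ f x (0, 1) := by
  have h : HasDerivAt (fun t : ℝ => (x.1, t)) ((0 : ℝ), (1 : ℝ)) x.2 :=
    (hasDerivAt_const x.2 x.1).prodMk (hasDerivAt_id x.2)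
  exact (HasFDerivAt.comp_hasDerivAt (l := f) x.2 hf.hasFDerivAt h).deriv

lemma fderiv_apply_eq_rpd {f : ℝ × ℝ → ℝ} {x : ℝ × ℝ} (hf : DifferentiableAt ℝ f x)
    (u : ℝ × ℝ) : fderiv ℝ f x u = u.1 * rpd1 f x + u.2 * rpd2 f x := by
  have hu : u = u.1 • ((1 : ℝ), (0 : ℝ)) + u.2 • ((0 : ℝ), (1 : ℝ)) := by ext <;> simp
  rw [rpd1_eq_fderiv hf, rpd2_eq_fderiv hf]
  conv_lhs => rw [hu]
  rw [map_add, map_smul, map_smul, smul_eq_mul, smul_eq_mul]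

/-- The Hamiltonian vector field of `H`. -/
def hamiltonianField (H : ℝ × ℝ → ℝ) (y : ℝ × ℝ) : ℝ × ℝ := (-rpd2 H y, rpd1 H y)

lemma contDiff_hamiltonianField {H : ℝ × ℝ → ℝ} (hH : ContDiff ℝ (⊤ : ℕ∞) H) :
    ContDiff ℝ 1 (hamiltonianField H) := by
  have hd : Differentiable ℝ H := hH.differentiable (by simp)
  have hf : ContDiff ℝ 1 (fderiv ℝ H) := hH.fderiv_right (by norm_cast)
  have heq : hamiltonianField H = fun y => (-(fderiv ℝ H y (0, 1)), fderiv ℝ H y (1, 0)) := by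
    funext y
    rw [hamiltonianField, rpd1_eq_fderiv (hd y), rpd2_eq_fderiv (hd y)]
  rw [heq]
  fun_prop

lemma hamiltonianField_add_of_periodic {H : ℝ × ℝ → ℝ} {v : ℝ × ℝ}
    (h : ∀ y, H (y + v) = H y) (y : ℝ × ℝ) :
    hamiltonianField H (y + v) = hamiltonianField H y := by
  have h1 : rpd1 H (y + v) = rpd1 H y := by
    have : (fun t => H (t, y.2)) = fun t => H (t + v.1, (y + v).2) :=
      funext fun t => (h (t, y.2)).symm
    rw [rpd1, rpd1, this, deriv_comp_add_const (fun t => H (t, (y + v).2))]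
    rfl
  have h2 : rpd2 H (y + v) = rpd2 H y := by
    have : (fun t => H (y.1, t)) = fun t => H ((y + v).1, t + v.2) :=
      funext fun t => (h (y.1, t)).symm
    rw [rpd2, rpd2, this, deriv_comp_add_const (fun t => H ((y + v).1, t))]
    rfl
  rw [hamiltonianField, hamiltonianField, h1, h2]

/-- The energy is conserved along solutions of the Hamiltonian system. -/
lemma energy_eq_of_hasDerivAt {H : ℝ × ℝ → ℝ} (hd : Differentiable ℝ H) {c : ℝ → ℝ × ℝ}
    (hc : ∀ t, HasDerivAt c (hamiltonianField H (c t)) t) (s t : ℝ) : H (c s) = H (c t) := by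
  have h : ∀ t, HasDerivAt (fun t => H (c t)) 0 t := fun t => by
    have := HasFDerivAt.comp_hasDerivAt (l := H) t (hd (c t)).hasFDerivAt (hc t)
    have h0 : fderiv ℝ H (c t) (hamiltonianField H (c t)) = 0 := by
      rw [fderiv_apply_eq_rpd (hd (c t)), hamiltonianField]
      ring
    rwa [h0] at this
  exact is_const_of_deriv_eq_zero (fun t => (h t).differentiableAt) (fun t => (h t).deriv) s t

/-- A lattice spanned by two linearly independent vectors of the plane is cocompact. -/
lemma exists_isCompact_lattice_translate_mem {a₁ a₂ : ℝ × ℝ}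
    (hindep : LinearIndependent ℝ ![a₁, a₂]) :
    ∃ K : Set (ℝ × ℝ), IsCompact K ∧ ∀ y, ∃ l₁ l₂ : ℤ, y + (l₁ • a₁ + l₂ • a₂) ∈ K := by
  refine ⟨(fun r : ℝ × ℝ => r.1 • a₁ + r.2 • a₂) '' (Set.Icc 0 1 ×ˢ Set.Icc 0 1),
    (isCompact_Icc.prod isCompact_Icc).image (by fun_prop), fun y => ?_⟩
  let b := basisOfLinearIndependentOfCardEqFinrank hindep (by simp)
  obtain ⟨u, v, rfl⟩ : ∃ u v : ℝ, u • a₁ + v • a₂ = y :=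
    ⟨b.repr y 0, b.repr y 1, by simpa [b, Fin.sum_univ_two] using b.sum_repr y⟩
  refine ⟨-⌊u⌋, -⌊v⌋, (Int.fract u, Int.fract v),
    ⟨⟨Int.fract_nonneg _, (Int.fract_lt_one _).le⟩,
      ⟨Int.fract_nonneg _, (Int.fract_lt_one _).le⟩⟩, ?_⟩
  simp only [Int.fract, ← Int.cast_smul_eq_zsmul ℝ, Int.cast_neg]
  module

/-- A continuous function on the plane that is periodic under a lattice is bounded. -/
lemma exists_norm_le_of_lattice_periodic {E : Type*} [NormedAddCommGroup E] {a₁ a₂ : ℝ × ℝ}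
    (hindep : LinearIndependent ℝ ![a₁, a₂]) {f : ℝ × ℝ → E} (hf : Continuous f)
    (hper : ∀ (l₁ l₂ : ℤ) (y : ℝ × ℝ), f (y + (l₁ • a₁ + l₂ • a₂)) = f y) :
    ∃ C, ∀ y, ‖f y‖ ≤ C := by
  obtain ⟨K, hK, hmem⟩ := exists_isCompact_lattice_translate_mem hindep
  obtain ⟨C, hC⟩ := hK.exists_bound_of_continuousOn hf.continuousOn
  refine ⟨C, fun y => ?_⟩
  obtain ⟨l₁, l₂, hl⟩ := hmem y
  rw [← hper l₁ l₂]
  exact hC _ hl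

/-- Near a regular point `p`, every solution on the energy level of `p` passes through `p`
within a short time. -/
lemma eventually_exists_solution_eq {H : ℝ × ℝ → ℝ} (hH : ContDiff ℝ (⊤ : ℕ∞) H) {M : ℝ}
    (hM : ∀ y, ‖hamiltonianField H y‖ ≤ M) {p : ℝ × ℝ} (hp : (rpd1 H p, rpd2 H p) ≠ (0, 0))
    {δ : ℝ} (hδ : 0 < δ) :
    ∀ᶠ q in 𝓝 p, ∀ c : ℝ → ℝ × ℝ, (∀ t, HasDerivAt c (hamiltonianField H (c t)) t) →
      c 0 = q → H q = H p → ∃ s, |s| ≤ δ ∧ c s = p := by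
  have hd : Differentiable ℝ H := hH.differentiable (by simp)
  have hcont : Continuous (hamiltonianField H) := (contDiff_hamiltonianField hH).continuous
  have hM0 : 0 ≤ M := (norm_nonneg _).trans (hM p)
  -- The linear functional pairing with the field at `p`.
  let ℓ : ℝ × ℝ →L[ℝ] ℝ :=
    (-rpd2 H p) • ContinuousLinearMap.fst ℝ ℝ ℝ + (rpd1 H p) • ContinuousLinearMap.snd ℝ ℝ ℝ
  have hℓ : ∀ u, ℓ u = -rpd2 H p * u.1 + rpd1 H p * u.2 := fun u => by simp [ℓ]
  have hpos : 0 < ℓ (hamiltonianField H p) := by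
    rw [hℓ]
    simp only [hamiltonianField]
    by_contra hcon
    have h1 : rpd1 H p = 0 := by nlinarith [sq_nonneg (rpd1 H p), sq_nonneg (rpd2 H p)]
    have h2 : rpd2 H p = 0 := by nlinarith [sq_nonneg (rpd1 H p), sq_nonneg (rpd2 H p)]
    exact hp (by rw [h1, h2])
  obtain ⟨m, hm0, hm⟩ := exists_between hpos
  obtain ⟨r, hr, hball⟩ := Metric.eventually_nhds_iff_ball.1
    ((ℓ.continuous.comp hcont).continuousAt.eventually (lt_mem_nhds hm))
  have hinj : ∀ y ∈ Metric.ball p r, H y = H p → ℓ y = ℓ p → y = p := by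
    intro y hy hHy hℓy
    obtain ⟨z, hz, hzeq⟩ := domain_mvt (f := H) (s := Metric.ball p r)
      (fun x _ => (hd x).hasFDerivAt.hasFDerivWithinAt) (convex_ball p r)
      (Metric.mem_ball_self hr) hy
    have hzb := hball z ((convex_ball p r).segment_subset (Metric.mem_ball_self hr) hy hz)
    rw [fderiv_apply_eq_rpd (hd z), hHy, sub_self] at hzeq
    have hℓ0 : ℓ (y - p) = 0 := by rw [map_sub, hℓy, sub_self]
    rw [hℓ] at hℓ0
    simp only [Function.comp_apply, hℓ, hamiltonianField] at hzb
    have hD : rpd1 H p * rpd1 H z + rpd2 H p * rpd2 H z ≠ 0 := by nlinarith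
    have h1 : (y - p).1 = 0 := by
      refine (mul_eq_zero.1 ?_).resolve_left hD
      linear_combination -rpd1 H p * hzeq - rpd2 H z * hℓ0
    have h2 : (y - p).2 = 0 := by
      refine (mul_eq_zero.1 ?_).resolve_left hD
      linear_combination -rpd2 H p * hzeq + rpd1 H z * hℓ0
    exact sub_eq_zero.1 (Prod.ext h1 h2)
  obtain ⟨η, hη0, hηδ, hηr⟩ : ∃ η, 0 < η ∧ η ≤ δ ∧ M * η < r / 2 := by
    refine ⟨min δ (r / (2 * (M + 1))), by positivity, min_le_left _ _, ?_⟩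
    have h := min_le_right δ (r / (2 * (M + 1)))
    have h0 : 0 < min δ (r / (2 * (M + 1))) := by positivity
    rw [le_div_iff₀ (by positivity)] at h
    nlinarith
  have hℓnear : ∀ᶠ q in 𝓝 p, |ℓ q - ℓ p| < m * η := by
    have : ContinuousAt (fun q => |ℓ q - ℓ p|) p := by fun_prop
    exact this.eventually (gt_mem_nhds (by simpa using mul_pos hm0 hη0))
  filter_upwards [Metric.ball_mem_nhds p (half_pos hr), hℓnear] with q hq hℓq c hc hc0 hHq
  have hmem : ∀ s ∈ Set.Icc (-η) η, c s ∈ Metric.ball p r := by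
    intro s hs
    have h := convex_univ.norm_image_sub_le_of_norm_hasDerivWithin_le (𝕜 := ℝ)
      (fun t _ => (hc t).hasDerivWithinAt) (fun t _ => hM (c t)) (Set.mem_univ 0) (Set.mem_univ s)
    rw [hc0, sub_zero, Real.norm_eq_abs, ← dist_eq_norm] at h
    have hs' : M * |s| ≤ M * η := mul_le_mul_of_nonneg_left (abs_le.2 hs) hM0
    rw [Metric.mem_ball] at hq ⊢
    linarith [dist_triangle (c s) q p]
  have hderiv : ∀ t, HasDerivAt (fun t => ℓ (c t)) (ℓ (hamiltonianField H (c t))) t :=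
    fun t => HasFDerivAt.comp_hasDerivAt (l := ℓ) t ℓ.hasFDerivAt (hc t)
  have hcc : Continuous fun t => ℓ (c t) :=
    continuous_iff_continuousAt.2 fun t => (hderiv t).continuousAt
  have hgrow := (convex_Icc (-η) η).mul_sub_le_image_sub_of_le_deriv hcc.continuousOn
    (fun t _ => (hderiv t).differentiableAt.differentiableWithinAt) (C := m)
    (fun t ht => by
      rw [(hderiv t).deriv]
      exact (hball _ (hmem t (interior_subset ht))).le)
  have h0mem : (0 : ℝ) ∈ Set.Icc (-η) η := ⟨by linarith, hη0.le⟩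
  have hright := hgrow 0 h0mem η ⟨by linarith, le_rfl⟩ hη0.le
  have hleft := hgrow (-η) ⟨le_rfl, by linarith⟩ 0 h0mem (by linarith)
  rw [hc0] at hright hleft
  obtain ⟨hlo, hhi⟩ := abs_lt.1 hℓq
  obtain ⟨s, hs, hsℓ⟩ := intermediate_value_Icc (by linarith : -η ≤ η) hcc.continuousOn
    (show ℓ p ∈ Set.Icc (ℓ (c (-η))) (ℓ (c η)) from ⟨by linarith, by linarith⟩)
  refine ⟨s, (abs_le.2 hs).trans hηδ, hinj _ (hmem s hs) ?_ hsℓ⟩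
  rw [energy_eq_of_hasDerivAt hd hc s 0, hc0, hHq]

theorem stmt_11 (a₁ a₂ : ℝ × ℝ) (hindep : LinearIndependent ℝ ![a₁, a₂])
    (H : ℝ × ℝ → ℝ) (hH : ContDiff ℝ (⊤ : ℕ∞) H)
    (hper : ∀ (y : ℝ × ℝ) (l₁ l₂ : ℤ), H (y + l₁ • a₁ + l₂ • a₂) = H y)
    (γ : ℝ → ℝ × ℝ)
    (hγ : ∀ t, HasDerivAt γ (-rpd2 H (γ t), rpd1 H (γ t)) t)
    (hreg : ∀ y : ℝ × ℝ, H y = H (γ 0) → (rpd1 H y, rpd2 H y) ≠ (0, 0)) :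
    ∃ T > 0, ∃ d₁ d₂ : ℤ, ∀ t, γ (t + T) = γ t + d₁ • a₁ + d₂ • a₂ := by
  have hd : Differentiable ℝ H := hH.differentiable (by simp)
  have hsol : ∀ t, HasDerivAt γ (hamiltonianField H (γ t)) t := hγ
  have hHper : ∀ (l₁ l₂ : ℤ) (y : ℝ × ℝ), H (y + (l₁ • a₁ + l₂ • a₂)) = H y :=
    fun l₁ l₂ y => by rw [← add_assoc, hper]
  have hXper : ∀ (l₁ l₂ : ℤ) (y : ℝ × ℝ),
      hamiltonianField H (y + (l₁ • a₁ + l₂ • a₂)) = hamiltonianField H y :=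
    fun l₁ l₂ => hamiltonianField_add_of_periodic (hHper l₁ l₂)
  have hX : ContDiff ℝ 1 (hamiltonianField H) := contDiff_hamiltonianField hH
  obtain ⟨M, hM⟩ := exists_norm_le_of_lattice_periodic hindep hX.continuous hXper
  obtain ⟨L, hL⟩ := exists_norm_le_of_lattice_periodic hindep
    (hX.continuous_fderiv one_ne_zero) fun l₁ l₂ y => by
      rw [← fderiv_comp_add_right, funext (hXper l₁ l₂)]
  have hLip : LipschitzWith L.toNNReal (hamiltonianField H) :=
    lipschitzWith_of_nnnorm_fderiv_le (hX.differentiable one_ne_zero)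
      fun y => NNReal.le_toNNReal_of_coe_le (hL y)
  -- Translates of `γ` in time and by lattice vectors are solutions.
  have hshift : ∀ (T : ℝ) (l₁ l₂ : ℤ) (t : ℝ),
      HasDerivAt (fun t => γ (t + T) + (l₁ • a₁ + l₂ • a₂))
        (hamiltonianField H (γ (t + T) + (l₁ • a₁ + l₂ • a₂))) t := fun T l₁ l₂ t => by
    rw [hXper]
    exact ((hsol (t + T)).comp_add_const t T).add_const _
  obtain ⟨K, hK, hmem⟩ := exists_isCompact_lattice_translate_mem hindep
  choose k₁ k₂ hk using fun n : ℕ => hmem (γ n)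
  obtain ⟨p, -, φ, hφ, hlim⟩ := hK.tendsto_subseq hk
  have hlevel : ∀ n : ℕ, H (γ n + (k₁ n • a₁ + k₂ n • a₂)) = H (γ 0) := fun n => by
    rw [hHper, energy_eq_of_hasDerivAt hd hsol n 0]
  have hHp : H p = H (γ 0) :=
    tendsto_nhds_unique ((hd.continuous.tendsto p).comp hlim)
      (tendsto_const_nhds.congr fun n => (hlevel (φ n)).symm)
  obtain ⟨N, hN⟩ := eventually_atTop.1 (hlim.eventually
    (eventually_exists_solution_eq hH hM (hreg p hHp) (δ := 1 / 4) (by norm_num)))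
  have hhit : ∀ n ≥ N, ∃ s : ℝ, |s| ≤ 1 / 4 ∧
      γ (s + φ n) + (k₁ (φ n) • a₁ + k₂ (φ n) • a₂) = p := fun n hn =>
    hN n hn _ (hshift (φ n) (k₁ (φ n)) (k₂ (φ n))) (by simp) ((hlevel _).trans hHp.symm)
  obtain ⟨s, hs, hsp⟩ := hhit N le_rfl
  obtain ⟨s', hs', hsp'⟩ := hhit (N + 1) N.le_succ
  have hlt : (φ N : ℝ) + 1 ≤ φ (N + 1) := by exact_mod_cast hφ N.lt_succ_self
  refine ⟨s' + φ (N + 1) - (s + φ N), by linarith [(abs_le.1 hs).2, (abs_le.1 hs').1],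
    k₁ (φ N) - k₁ (φ (N + 1)), k₂ (φ N) - k₂ (φ (N + 1)), fun t => ?_⟩
  have huniq := ODE_solution_unique_univ (v := fun _ => hamiltonianField H)
    (s := fun _ => Set.univ) (t₀ := s + φ N) (fun _ => hLip.lipschitzOnWith)
    (fun t => ⟨hshift (s' + φ (N + 1) - (s + φ N)) 0 0 t, Set.mem_univ _⟩)
    (fun t => ⟨hshift 0 (k₁ (φ N) - k₁ (φ (N + 1))) (k₂ (φ N) - k₂ (φ (N + 1))) t,
      Set.mem_univ _⟩)
    (by
      simp only [add_sub_cancel, zero_smul, add_zero, sub_smul]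
      rw [← eq_sub_iff_add_eq] at hsp hsp'
      rw [hsp, hsp']
      abel)
  simpa [add_assoc] using congrFun huniq t
end
end

section
/- Let a₁, a₂ ∈ ℝ² be linearly independent over ℝ and let Γ = { l₁a₁ + l₂a₂ : l₁, l₂ ∈ ℤ }. Let H : ℝ² → ℝ be smooth and Γ-periodic. Let γ : ℝ → ℝ² be a continuously differentiable solution of γ'(t) = ( −∂H/∂y₂(γ(t)), ∂H/∂y₁(γ(t)) ), and suppose there are T > 0 and d = (d₁,d₂) ∈ ℤ² with d ≠ (0,0) such that γ(t+T) = γ(t) + d₁a₁ + d₂a₂ for all t, and such that γ(t) − γ(s) ∉ Γ whenever 0 ≤ s < t < T. Then d is primitive: the greatest common divisor of d₁ and d₂ equals 1 (with the convention gcd(0,n) = |n|). -/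
open Real

noncomputable section

/-- A continuous angle that starts at an odd multiple of `π`, keeps a nonnegative sine on `[0, T]`
and ends at a different value has decreased. -/
theorem lt_of_forall_sin_nonneg {θ : ℝ → ℝ} (hθ : Continuous θ) {T : ℝ} (hT : 0 ≤ T)
    (hsin : ∀ u ∈ Set.Icc 0 T, 0 ≤ sin (θ u)) (h₀ : sin (θ 0) = 0) (h₁ : cos (θ 0) < 0)
    (hne : θ T ≠ θ 0) : θ T < θ 0 := by
  by_contra! hle
  have hlt : θ 0 < θ T := lt_of_le_of_ne hle hne.symm
  set ε := min (π / 2) (θ T - θ 0)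
  have hε : 0 < ε := lt_min (by positivity) (by linarith)
  have hεπ : ε < π := (min_le_left _ _).trans_lt (by linarith [pi_pos])
  have hεT : ε ≤ θ T - θ 0 := min_le_right _ _
  obtain ⟨u, hu, hueq⟩ := intermediate_value_Icc hT hθ.continuousOn
    (show θ 0 + ε ∈ Set.Icc (θ 0) (θ T) from ⟨by linarith, by linarith⟩)
  have hs := hsin u hu
  rw [hueq, sin_add, h₀, zero_mul, zero_add] at hs
  exact hs.not_gt (mul_neg_of_neg_of_pos h₁ (sin_pos_of_pos_of_lt_pi hε hεπ))

/-- A nowhere vanishing continuous complex function on the plane has a continuous logarithm. -/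
theorem exists_continuous_exp_eq {F : ℝ × ℝ → ℂ} (hF : Continuous F) (h : ∀ x, F x ≠ 0) :
    ∃ Φ : ℝ × ℝ → ℂ, Continuous Φ ∧ ∀ x, Complex.exp (Φ x) = F x := by
  obtain ⟨Φ, ⟨-, hΦ⟩, -⟩ := Complex.isCoveringMapOn_exp.existsUnique_continuousMap_lifts
    ⟨F, hF⟩ (a₀ := 0) (Complex.exp_log (h 0)) h
  exact ⟨Φ, Φ.continuous, congrFun hΦ⟩

/-- A continuous planar curve that is periodic up to translation by `L > 0` has, within one
period, a chord equal to any prescribed `c ∈ (0, L)`. -/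
theorem exists_chord_eq {g : ℝ → ℂ} (hg : Continuous g) {T L c : ℝ} (hT : 0 < T)
    (hgT : ∀ t, g (t + T) = g t + L) (hc : 0 < c) (hcL : c < L) :
    ∃ s, ∃ u ∈ Set.Ioo 0 T, g (s + u) - g s = c := by
  by_contra! hno
  let F : ℝ × ℝ → ℂ := fun x => g (x.1 + max 0 (min x.2 T)) - g x.1 - c
  have hF_of_mem (s : ℝ) {u : ℝ} (hu : u ∈ Set.Icc 0 T) : F (s, u) = g (s + u) - g s - c := by
    simp [F, hu.1, hu.2]
  have hF_zero (s : ℝ) : F (s, 0) = ((-c : ℝ) : ℂ) := by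
    rw [hF_of_mem s ⟨le_rfl, hT.le⟩]; simp
  have hF_T (s : ℝ) : F (s, T) = ((L - c : ℝ) : ℂ) := by
    rw [hF_of_mem s ⟨hT.le, le_rfl⟩, hgT]; push_cast; ring
  have hF_ne : ∀ x, F x ≠ 0 := by
    rintro ⟨s, u⟩
    have key : ∀ v ∈ Set.Icc 0 T, g (s + v) - g s - c ≠ 0 := by
      intro v hv
      rcases hv.1.eq_or_lt with rfl | h0
      · simpa using hc.ne'
      rcases hv.2.eq_or_lt with rfl | h1
      · rw [hgT, add_sub_cancel_left, sub_ne_zero]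
        exact_mod_cast hcL.ne'
      · exact sub_ne_zero.mpr (hno s v ⟨h0, h1⟩)
    exact key _ ⟨le_max_left _ _, max_le hT.le (min_le_right _ _)⟩
  obtain ⟨Φ, hΦ, hexp⟩ := exists_continuous_exp_eq (by fun_prop : Continuous F) hF_ne
  have him (x : ℝ × ℝ) : (F x).im = Real.exp (Φ x).re * sin (Φ x).im := by
    rw [← hexp, Complex.exp_im]
  have hre (x : ℝ × ℝ) : (F x).re = Real.exp (Φ x).re * cos (Φ x).im := by
    rw [← hexp, Complex.exp_re]
  have hsin_zero (s : ℝ) : sin (Φ (s, 0)).im = 0 := by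
    have := him (s, 0)
    rw [hF_zero, Complex.ofReal_im] at this
    simpa using this.symm
  have hcos_zero (s : ℝ) : cos (Φ (s, 0)).im < 0 := by
    have := hre (s, 0)
    rw [hF_zero, Complex.ofReal_re] at this
    by_contra! h
    nlinarith [mul_nonneg (Real.exp_pos (Φ (s, 0)).re).le h]
  have hcos_T (s : ℝ) : 0 < cos (Φ (s, T)).im := by
    have := hre (s, T)
    rw [hF_T, Complex.ofReal_re] at this
    exact pos_of_mul_pos_right (this ▸ sub_pos.mpr hcL) (Real.exp_pos _).le
  have hne (s : ℝ) : (Φ (s, T)).im ≠ (Φ (s, 0)).im := fun h =>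
    (hcos_zero s).not_gt (h ▸ hcos_T s)
  have hper : Function.Periodic (fun t => (g t).im) T := fun t => by simp [hgT]
  have hcomp := hper.compact_of_continuous hT.ne' (by fun_prop)
  obtain ⟨-, ⟨s₁, rfl⟩, hmax⟩ := hcomp.exists_isGreatest (Set.range_nonempty _)
  obtain ⟨-, ⟨s₀, rfl⟩, hmin⟩ := hcomp.exists_isLeast (Set.range_nonempty _)
  have hdec : (Φ (s₀, T)).im < (Φ (s₀, 0)).im := by
    refine lt_of_forall_sin_nonneg (θ := fun u => (Φ (s₀, u)).im) (by fun_prop) hT.le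
      (fun u hu => ?_) (hsin_zero s₀) (hcos_zero s₀) (hne s₀)
    have h := him (s₀, u)
    have hle : (g s₀).im ≤ (g (s₀ + u)).im := hmin ⟨_, rfl⟩
    rw [hF_of_mem s₀ hu] at h
    simp only [Complex.sub_im, Complex.ofReal_im, sub_zero] at h
    exact nonneg_of_mul_nonneg_right (h ▸ sub_nonneg.mpr hle) (Real.exp_pos _)
  have hinc : (Φ (s₁, 0)).im < (Φ (s₁, T)).im := by
    refine neg_lt_neg_iff.mp (lt_of_forall_sin_nonneg (θ := fun u => -(Φ (s₁, u)).im)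
      (by fun_prop) hT.le (fun u hu => ?_) (by simp [hsin_zero s₁])
      (by simpa using hcos_zero s₁) (neg_injective.ne (hne s₁)))
    have h := him (s₁, u)
    have hle : (g (s₁ + u)).im ≤ (g s₁).im := hmax ⟨_, rfl⟩
    rw [hF_of_mem s₁ hu] at h
    simp only [Complex.sub_im, Complex.ofReal_im, sub_zero] at h
    rw [sin_neg]
    refine nonneg_of_mul_nonneg_right (a := Real.exp (Φ (s₁, u)).re) ?_ (Real.exp_pos _)
    linarith
  obtain ⟨s, hs⟩ := mem_range_of_exists_le_of_exists_ge
    (f := fun s => (Φ (s, T)).im - (Φ (s, 0)).im) (c := 0) (by fun_prop)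
    ⟨s₀, by linarith⟩ ⟨s₁, by linarith⟩
  exact hne s (sub_eq_zero.mp hs)

/-- The planar chord theorem for curves in `ℝ × ℝ`: a continuous curve that is periodic up to
translation by `k • e`, with `k > 1` and `e ≠ 0`, has the chord `e` within one period. -/
theorem exists_sub_eq_of_add_period {γ : ℝ → ℝ × ℝ} (hγ : Continuous γ) {T k : ℝ} (hT : 0 < T)
    (hk : 1 < k) {e : ℝ × ℝ} (he : e ≠ 0) (hper : ∀ t, γ (t + T) = γ t + k • e) :
    ∃ s, ∃ u ∈ Set.Ioo 0 T, γ (s + u) - γ s = e := by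
  have hpos : 0 < e.1 ^ 2 + e.2 ^ 2 := by
    by_contra! h
    exact he (Prod.ext (by simp; nlinarith) (by simp; nlinarith))
  obtain ⟨s, u, hu, h⟩ := exists_chord_eq
    (g := fun t => ⟨e.1 * (γ t).1 + e.2 * (γ t).2, e.1 * (γ t).2 - e.2 * (γ t).1⟩)
    (L := k * (e.1 ^ 2 + e.2 ^ 2))
    ((Complex.equivRealProdCLM.symm.continuous.comp
      (f := fun t => (e.1 * (γ t).1 + e.2 * (γ t).2, e.1 * (γ t).2 - e.2 * (γ t).1))
      (by fun_prop))) hT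
    (fun t => by
      apply Complex.ext
      · simp [hper, -Complex.ofReal_mul]; ring
      · simp [hper, -Complex.ofReal_mul]; ring)
    hpos (by nlinarith)
  refine ⟨s, u, hu, ?_⟩
  have h₁ := congrArg Complex.re h
  have h₂ := congrArg Complex.im h
  rw [Complex.ofReal_re] at h₁
  rw [Complex.ofReal_im] at h₂
  simp only [Complex.sub_re, Complex.sub_im] at h₁ h₂
  refine Prod.ext (mul_left_cancel₀ hpos.ne' ?_) (mul_left_cancel₀ hpos.ne' ?_)
  · simp only [Prod.fst_sub]
    linear_combination e.1 * h₁ - e.2 * h₂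
  · simp only [Prod.snd_sub]
    linear_combination e.2 * h₁ + e.1 * h₂

theorem stmt_12 (a₁ a₂ : ℝ × ℝ) (hindep : LinearIndependent ℝ ![a₁, a₂])
    (H : ℝ × ℝ → ℝ) (hH : ContDiff ℝ (⊤ : ℕ∞) H)
    (hper : ∀ (y : ℝ × ℝ) (l₁ l₂ : ℤ), H (y + l₁ • a₁ + l₂ • a₂) = H y)
    (γ : ℝ → ℝ × ℝ)
    (hγ : ∀ t, HasDerivAt γ (-rpd2 H (γ t), rpd1 H (γ t)) t)
    (T : ℝ) (hT : 0 < T) (d₁ d₂ : ℤ) (hd : ¬(d₁ = 0 ∧ d₂ = 0))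
    (hper' : ∀ t, γ (t + T) = γ t + d₁ • a₁ + d₂ • a₂)
    (hinj : ∀ s t : ℝ, 0 ≤ s → s < t → t < T →
      ¬∃ l₁ l₂ : ℤ, γ t - γ s = l₁ • a₁ + l₂ • a₂) :
    Int.gcd d₁ d₂ = 1 := by
  have hg0 : Int.gcd d₁ d₂ ≠ 0 := fun h => hd (Int.gcd_eq_zero_iff.mp h)
  by_contra hg1
  have hk : (1 : ℝ) < (Int.gcd d₁ d₂ : ℝ) := by
    exact_mod_cast (by omega : 1 < Int.gcd d₁ d₂)
  obtain ⟨e₁, he₁⟩ := Int.gcd_dvd_left d₁ d₂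
  obtain ⟨e₂, he₂⟩ := Int.gcd_dvd_right d₁ d₂
  generalize Int.gcd d₁ d₂ = k at *
  have he : e₁ • a₁ + e₂ • a₂ ≠ 0 := by
    intro h
    have h' := LinearIndependent.pair_iff.mp hindep e₁ e₂
      (by simpa only [Int.cast_smul_eq_zsmul] using h)
    have h₁ : e₁ = 0 := by exact_mod_cast h'.1
    have h₂ : e₂ = 0 := by exact_mod_cast h'.2
    exact hd ⟨by simp [he₁, h₁], by simp [he₂, h₂]⟩
  obtain ⟨s, u, hu, hsu⟩ := exists_sub_eq_of_add_period
    (continuous_iff_continuousAt.mpr fun t => (hγ t).continuousAt) hT hk he fun t => by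
      rw [hper', he₁, he₂, mul_smul, mul_smul, add_assoc, ← smul_add, natCast_zsmul,
        Nat.cast_smul_eq_nsmul]
  have hchord : Function.Periodic (fun s => γ (s + u) - γ s) T := fun s => by
    simp only [add_right_comm s T u, hper']
    abel
  obtain ⟨r, hr, hrs⟩ := hchord.exists_mem_Ico₀ hT s
  have hru : γ (r + u) - γ r = e₁ • a₁ + e₂ • a₂ := hrs.symm.trans hsu
  rcases lt_or_ge (r + u) T with hlt | hge
  · exact hinj r (r + u) hr.1 (by linarith [hu.1]) hlt ⟨e₁, e₂, hru⟩
  · refine hinj (r + u - T) r (by linarith) (by linarith [hu.2]) hr.2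
      ⟨d₁ - e₁, d₂ - e₂, ?_⟩
    have h := hper' (r + u - T)
    rw [sub_add_cancel] at h
    rw [h] at hru
    rw [sub_smul, sub_smul, ← sub_eq_zero, ← sub_eq_zero.mpr hru.symm]
    abel
end
end
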